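/- Let L_1,…,L_r be nonzero homogeneous linear forms in F⟨x_1,…,x_n⟩ that are pairwise non-proportional (no L_i is an F-scalar multiple of L_j for i ≠ j). For words u, v : {1,…,D} → {1,…,r}, the products L_{u(1)}·L_{u(2)}·⋯·L_{u(D)} and L_{v(1)}·L_{v(2)}·⋯·L_{v(D)} are nonzero, and they are F-scalar multiples of each other (i.e., one equals α times the other for some α ∈ F\{0}) if and only if u = v. -/

import Mathlib

/-!
STATEMENT 5: For nonzero pairwise non-proportional homogeneous linear forms `L_1,…,L_r`
and words `u, v : [D] → [r]`, the products `L_{u(1)}⋯L_{u(D)}` and `L_{v(1)}⋯L_{v(D)}`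
are nonzero, and they are scalar multiples of each other iff `u = v`.
-/

noncomputable section

/-- The free noncommutative polynomial algebra `F⟨x_1,…,x_n⟩`, realized as the monoid
algebra of the free monoid of words over `Fin n`. -/
abbrev FreeNC (F : Type*) [CommSemiring F] (n : ℕ) : Type _ :=
  MonoidAlgebra F (FreeMonoid (Fin n))

/-- The homogeneous linear form `∑ i, c i * x i` in `F⟨x_1,…,x_n⟩`. -/
def linForm {F : Type*} [CommSemiring F] {n : ℕ} (c : Fin n → F) : FreeNC F n :=
  ∑ i, MonoidAlgebra.single (FreeMonoid.of i) (c i)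

/-- Multiplying by a linear form on the left shifts coefficients along the first letter. -/
theorem coeff_linForm_mul {F : Type*} [CommSemiring F] {n : ℕ} (c : Fin n → F)
    (p : FreeNC F n) (i : Fin n) (w : FreeMonoid (Fin n)) :
    (linForm c * p).coeff (FreeMonoid.of i * w) = c i * p.coeff w := by
  rw [linForm, Finset.sum_mul, MonoidAlgebra.coeff_sum, Finsupp.finsetSum_apply,
    Finset.sum_eq_single i]
  · exact MonoidAlgebra.coeff_single_mul_mul ..
  · intro j _ hj
    refine MonoidAlgebra.coeff_single_mul_of_forall_mul_ne _ _ fun d h => hj ?_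
    have h' := congrArg FreeMonoid.toList h
    rw [FreeMonoid.toList_of_mul, FreeMonoid.toList_of_mul] at h'
    exact (List.cons.inj h').1
  · simp

/-- The coefficient of a word in a product of linear forms of the same length. -/
theorem coeff_prod_linForm {F : Type*} [CommSemiring F] {n D : ℕ} (c : Fin D → Fin n → F)
    (w : Fin D → Fin n) :
    (List.ofFn fun m => linForm (c m)).prod.coeff (FreeMonoid.ofList (List.ofFn w))
      = ∏ m, c m (w m) := by
  induction D with
  | zero =>
    simp [MonoidAlgebra.one_def]
  | succ D ih =>
    rw [List.ofFn_succ, List.ofFn_succ, List.prod_cons, FreeMonoid.ofList_cons,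
      coeff_linForm_mul, Fin.prod_univ_succ, ih (fun m => c m.succ) (fun m => w m.succ)]

/-- A product of nonzero linear forms is nonzero. -/
theorem prod_linForm_ne_zero {F : Type*} [Field F] {n D : ℕ} {c : Fin D → Fin n → F}
    (hc : ∀ m, c m ≠ 0) : (List.ofFn fun m => linForm (c m)).prod ≠ (0 : FreeNC F n) := by
  choose w hw using fun m => Function.ne_iff.mp (hc m)
  intro h
  have hcoeff := coeff_prod_linForm c w
  rw [h, MonoidAlgebra.coeff_zero, Finsupp.zero_apply] at hcoeff
  exact Finset.prod_ne_zero_iff.mpr (fun m _ => hw m) hcoeff.symm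

/-- If a product of nonzero linear forms is a multiple of another product of linear forms,
then each factor is a multiple of the corresponding factor. -/
theorem exists_eq_smul_of_prod_linForm_eq_smul {F : Type*} [Field F] {n D : ℕ}
    {a b : Fin D → Fin n → F} (ha : ∀ m, a m ≠ 0) {α : F}
    (h : (List.ofFn fun m => linForm (a m)).prod
      = α • (List.ofFn fun m => linForm (b m)).prod) (m : Fin D) :
    ∃ β : F, a m = β • b m := by
  choose w hw using fun m => Function.ne_iff.mp (ha m)
  have key (i : Fin n) : a m i * ∏ k ∈ Finset.univ.erase m, a k (w k)
      = α * (b m i * ∏ k ∈ Finset.univ.erase m, b k (w k)) := by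
    have split (c : Fin D → Fin n → F) : ∏ k, c k (Function.update w m i k)
        = c m i * ∏ k ∈ Finset.univ.erase m, c k (w k) := by
      rw [← Finset.mul_prod_erase _ _ (Finset.mem_univ m), Function.update_self]
      congr 1
      refine Finset.prod_congr rfl fun k hk => ?_
      rw [Function.update_of_ne (Finset.ne_of_mem_erase hk)]
    rw [← split, ← split, ← coeff_prod_linForm, ← coeff_prod_linForm, h,
      MonoidAlgebra.coeff_smul_apply, smul_eq_mul]
  have hA : ∏ k ∈ Finset.univ.erase m, a k (w k) ≠ 0 :=
    Finset.prod_ne_zero_iff.mpr fun k _ => hw k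
  refine ⟨α * (∏ k ∈ Finset.univ.erase m, b k (w k)) / ∏ k ∈ Finset.univ.erase m, a k (w k),
    funext fun i => ?_⟩
  rw [Pi.smul_apply, smul_eq_mul, div_mul_eq_mul_div, eq_div_iff hA, key i]
  ring

theorem stmt5 {F : Type*} [Field F] {n r D : ℕ}
    (L : Fin r → Fin n → F)
    (hL0 : ∀ j, L j ≠ 0)
    (hprop : ∀ j j' : Fin r, j ≠ j' → ∀ α : F, L j ≠ α • L j')
    (u v : Fin D → Fin r) :
    (List.ofFn fun m => linForm (L (u m))).prod ≠ (0 : FreeNC F n) ∧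
    (List.ofFn fun m => linForm (L (v m))).prod ≠ (0 : FreeNC F n) ∧
    ((∃ α : F, α ≠ 0 ∧
        (List.ofFn fun m => linForm (L (u m))).prod
          = α • (List.ofFn fun m => linForm (L (v m))).prod) ↔ u = v) := by
  refine ⟨prod_linForm_ne_zero fun m => hL0 (u m), prod_linForm_ne_zero fun m => hL0 (v m),
    ?_, ?_⟩
  · rintro ⟨α, -, h⟩
    funext m
    by_contra hne
    obtain ⟨β, hβ⟩ := exists_eq_smul_of_prod_linForm_eq_smul (fun m => hL0 (u m)) h m
    exact hprop _ _ hne β hβ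
  · rintro rfl
    exact ⟨1, one_ne_zero, (one_smul _ _).symm⟩

end
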